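/- The quasi-symmetric coinvariant algebra Q_n is a finite-dimensional ℚ-vector space of dimension equal to the Catalan number c_{n+1} = (1/(n+2))·binom(2n+2, n+1). -/

import Mathlib

open MvPolynomial

/-- A polynomial in `ℚ[x_1,…,x_{n+1}]` is quasi-symmetric if for every sequence
of positive exponents `m_1,…,m_k`, all monomials `x_{i_1}^{m_1}⋯x_{i_k}^{m_k}`
with `i_1 < ⋯ < i_k` have the same coefficient. -/
def IsQuasiSymmetric {n : ℕ} (P : MvPolynomial (Fin (n+1)) ℚ) : Prop :=
  ∀ (k : ℕ) (m : Fin k → ℕ), (∀ t, 0 < m t) →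
    ∀ i i' : Fin k → Fin (n+1), StrictMono i → StrictMono i' →
      MvPolynomial.coeff (∑ t, Finsupp.single (i t) (m t)) P =
      MvPolynomial.coeff (∑ t, Finsupp.single (i' t) (m t)) P

/-- The ideal `I_n` generated by the quasi-symmetric polynomials with zero
constant term. -/
noncomputable def Iqs (n : ℕ) : Ideal (MvPolynomial (Fin (n+1)) ℚ) :=
  Ideal.span {P | IsQuasiSymmetric P ∧ MvPolynomial.coeff 0 P = 0}

section Fundamental

variable {A B : Type*} [CommRing A] [CommRing B]

/-- The fundamental quasi-symmetric polynomial in the list of variables `ys`, indexed by the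
composition whose parts are `a + 1` for `a` in the list `u`. -/
def fundamental : List A → List ℕ → A
  | [], [] => 1
  | [], _ :: _ => 0
  | _ :: _, [] => 1
  | y :: ys, 0 :: u => y * fundamental ys u + fundamental ys (0 :: u)
  | y :: ys, (a + 1) :: u => y * fundamental (y :: ys) (a :: u) + fundamental ys ((a + 1) :: u)
termination_by ys u => (ys.length, u.sum)

@[simp] lemma fundamental_nil_right (ys : List A) : fundamental ys [] = 1 := by
  cases ys <;> simp [fundamental]

lemma map_fundamental (φ : A →+* B) (ys : List A) (u : List ℕ) :
    φ (fundamental ys u) = fundamental (ys.map φ) u := by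
  induction ys, u using fundamental.induct <;> simp_all [fundamental]

lemma fundamental_zero_cons (ys : List A) (u : List ℕ) :
    fundamental (0 :: ys) u = fundamental ys u := by
  rcases u with _ | ⟨_ | a, u⟩ <;> simp [fundamental]

lemma fundamental_cons_congr (y : A) {ys zs : List A} (h : fundamental ys = fundamental zs) :
    fundamental (y :: ys) = fundamental (y :: zs) := by
  funext u
  rcases u with _ | ⟨a, u⟩
  · simp
  · induction a with
    | zero => simp [fundamental, h]
    | succ a ih => simp [fundamental, h, ih]

lemma fundamental_filter {ι : Type*} (P : ι → Prop) [DecidablePred P] (y : ι → A) (l : List ι)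
    (h : ∀ i ∈ l, ¬ P i → y i = 0) :
    fundamental ((l.filter P).map y) = fundamental (l.map y) := by
  induction l with
  | nil => rfl
  | cons i l ih =>
    have ih := ih fun j hj => h j (List.mem_cons_of_mem _ hj)
    by_cases hi : P i
    · simpa [hi] using fundamental_cons_congr (y i) ih
    · funext u
      simp [hi, h i, fundamental_zero_cons, ih]

/-- A family of polynomials `ε ↦ G_ε` with leading monomial `x^ε`, where `ε` is the reverse of `w`
followed by the composition whose parts are `a + 1` for `a` in `u`. -/
def compositionReduction (ys : List A) : List ℕ → List ℕ → A
  | [], u => fundamental ys u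
  | (b + 1) :: w, u => compositionReduction ys w (b :: u)
  | 0 :: w, [] => compositionReduction ys w []
  | 0 :: w, 0 :: u => compositionReduction ys w (0 :: u)
      - ys.getD w.length 0 * compositionReduction ys (0 :: w) u
  | 0 :: w, (a + 1) :: u => compositionReduction ys w ((a + 1) :: u)
      - ys.getD w.length 0 * compositionReduction ys w (a :: u)
termination_by w u => (w.length, u.length)

lemma compositionReduction_concat_zero (y : A) (ys : List A) (w u : List ℕ)
    (h : w.length + u.length ≤ ys.length) :
    compositionReduction (y :: ys) (w ++ [0]) u = compositionReduction ys w u := by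
  induction w, u using compositionReduction.induct with
  | case1 u =>
    induction u with
    | nil => simp [compositionReduction]
    | cons a u ih =>
      rcases a with _ | a
      · have := ih (by simp at h ⊢; omega)
        simp_all [compositionReduction, fundamental]
      · simp [compositionReduction, fundamental]
  | case2 b w u ih =>
    have := ih (by simp at h ⊢; omega)
    simpa [compositionReduction] using this
  | case3 w ih =>
    have := ih (by simp at h ⊢; omega)
    simpa [compositionReduction] using this
  | case4 w u ih1 ih2 =>
    have h1 := ih1 (by simp at h ⊢; omega)
    have h2 := ih2 (by simp at h ⊢; omega)
    simp only [List.cons_append] at h2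
    simp [compositionReduction, h1, h2]
  | case5 w a u ih1 ih2 =>
    have h1 := ih1 (by simp at h ⊢; omega)
    have h2 := ih2 (by simp at h ⊢; omega)
    simp [compositionReduction, h1, h2]

lemma fundamental_mem_subring (S : Subring A) (ys : List A) (u : List ℕ) (h : ∀ y ∈ ys, y ∈ S) :
    fundamental ys u ∈ S := by
  induction ys, u using fundamental.induct with
  | case1 => simp
  | case2 => simp [fundamental]
  | case3 => simp
  | case4 y ys u ih1 ih2 =>
    simp only [List.mem_cons, forall_eq_or_imp] at h
    rw [fundamental]
    exact S.add_mem (S.mul_mem h.1 (ih1 h.2)) (ih2 h.2)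
  | case5 y ys a u ih1 ih2 =>
    rw [fundamental]
    exact S.add_mem (S.mul_mem (h y (by simp)) (ih1 h)) (ih2 fun z hz => h z (by simp [hz]))

lemma getD_mem_subring (S : Subring A) (ys : List A) (h : ∀ y ∈ ys, y ∈ S) (k : ℕ) :
    ys.getD k 0 ∈ S := by
  by_cases hk : k < ys.length
  · simpa [hk] using h _ (List.getElem_mem hk)
  · rw [List.getD_eq_default _ _ (not_lt.mp hk)]
    exact S.zero_mem

lemma compositionReduction_mem_subring (S : Subring A) (ys : List A) (h : ∀ y ∈ ys, y ∈ S)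
    (w u : List ℕ) : compositionReduction ys w u ∈ S := by
  induction w, u using compositionReduction.induct with
  | case1 u =>
    rw [compositionReduction]
    exact fundamental_mem_subring S ys u h
  | case2 b w u ih => rwa [compositionReduction]
  | case3 w ih => rwa [compositionReduction]
  | case4 w u ih1 ih2 =>
    rw [compositionReduction]
    exact S.sub_mem ih1 (S.mul_mem (getD_mem_subring S ys h _) ih2)
  | case5 w a u ih1 ih2 =>
    rw [compositionReduction]
    exact S.sub_mem ih1 (S.mul_mem (getD_mem_subring S ys h _) ih2)

lemma compositionReduction_concat_succ (S : Subring A) (y : A) (ys : List A)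
    (hS : ∀ z ∈ ys, z ∈ S) (a : ℕ) (w u : List ℕ)
    (h : w.length + u.length ≤ ys.length) :
    compositionReduction (y :: ys) (w ++ [a + 1]) u
      - y * compositionReduction (y :: ys) (w ++ [a]) u ∈ S := by
  induction w, u using compositionReduction.induct with
  | case1 u =>
    rcases a with _ | a
    · have := compositionReduction_concat_zero y ys [] u h
      simp only [List.nil_append] at this ⊢
      rw [this]
      simp only [compositionReduction, fundamental, add_sub_cancel_left]
      exact fundamental_mem_subring S ys _ hS
    · simp only [List.nil_append, compositionReduction, fundamental, add_sub_cancel_left]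
      exact fundamental_mem_subring S ys _ hS
  | case2 b w u ih =>
    simpa [compositionReduction] using ih (by simp at h ⊢; omega)
  | case3 w ih =>
    simpa [compositionReduction] using ih (by simp at h ⊢; omega)
  | case4 w u ih1 ih2 =>
    have h1 := ih1 (by simp at h ⊢; omega)
    have h2 := ih2 (by simp at h ⊢; omega)
    convert S.sub_mem h1 (S.mul_mem (getD_mem_subring S ys hS w.length) h2) using 1
    simp only [List.cons_append, compositionReduction, List.length_append, List.length_singleton,
      List.getD_cons_succ]
    ring
  | case5 w a u ih1 ih2 =>
    have h1 := ih1 (by simp at h ⊢; omega)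
    have h2 := ih2 (by simp at h ⊢; omega)
    convert S.sub_mem h1 (S.mul_mem (getD_mem_subring S ys hS w.length) h2) using 1
    simp only [List.cons_append, compositionReduction, List.length_append, List.length_singleton,
      List.getD_cons_succ]
    ring

lemma compositionReduction_mem_ideal (I : Ideal A) (ys : List A)
    (hI : ∀ u, u ≠ [] → fundamental ys u ∈ I) (w u : List ℕ)
    (h : (∃ v, v <:+ w ∧ v ≠ [] ∧ v.length ≤ v.sum) ∨ (u ≠ [] ∧ w.length ≤ w.sum + u.sum)) :
    compositionReduction ys w u ∈ I := by
  induction w, u using compositionReduction.induct with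
  | case1 u =>
    rw [compositionReduction]
    refine hI u ?_
    rcases h with ⟨v, hv, hv', -⟩ | h
    · exact absurd (List.suffix_nil.mp hv) hv'
    · exact h.1
  | case2 b w u ih =>
    rw [compositionReduction]
    refine ih ?_
    rcases h with ⟨v, hv, hv', h⟩ | ⟨hu, h⟩
    · rcases List.suffix_cons_iff.mp hv with rfl | hv
      · right; simp at h ⊢; omega
      · exact Or.inl ⟨v, hv, hv', h⟩
    · right; simp at h ⊢; omega
  | case3 w ih =>
    rw [compositionReduction]
    refine ih ?_
    rcases h with ⟨v, hv, hv', h⟩ | ⟨hu, h⟩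
    · rcases List.suffix_cons_iff.mp hv with rfl | hv
      · refine Or.inl ⟨w, List.suffix_rfl, ?_, ?_⟩
        · rintro rfl; simp at h
        · simp at h; omega
      · exact Or.inl ⟨v, hv, hv', h⟩
    · exact absurd rfl hu
  | case4 w u ih1 ih2 =>
    rw [compositionReduction]
    refine I.sub_mem (ih1 ?_) (I.mul_mem_left _ (ih2 ?_))
    · rcases h with ⟨v, hv, hv', h⟩ | ⟨hu, h⟩
      · rcases List.suffix_cons_iff.mp hv with rfl | hv
        · right; simp at h ⊢; omega
        · exact Or.inl ⟨v, hv, hv', h⟩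
      · right; simp at h ⊢; omega
    · rcases h with h | ⟨hu, h⟩
      · exact Or.inl h
      · simp only [List.length_cons, List.sum_cons, zero_add] at h
        rcases u with _ | ⟨b, u⟩
        · refine Or.inl ⟨w, List.suffix_cons _ _, ?_, ?_⟩
          · rintro rfl; simp at h
          · simp at h; omega
        · right; simp at h ⊢; omega
  | case5 w a u ih1 ih2 =>
    rw [compositionReduction]
    refine I.sub_mem (ih1 ?_) (I.mul_mem_left _ (ih2 ?_)) <;>
    · rcases h with ⟨v, hv, hv', h⟩ | ⟨hu, h⟩
      · rcases List.suffix_cons_iff.mp hv with rfl | hv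
        · right; simp at h ⊢; omega
        · exact Or.inl ⟨v, hv, hv', h⟩
      · right; simp at h ⊢; omega

end Fundamental

lemma adjoin_le_span_compositionReduction {A : Type*} [CommRing A] [Algebra ℚ A] (ys : List A) :
    (Subalgebra.toSubmodule (Algebra.adjoin ℚ {y | y ∈ ys})) ≤
      Submodule.span ℚ ((fun w => compositionReduction ys w []) '' {w | w.length = ys.length}) := by
  induction ys with
  | nil =>
    have : {w : List ℕ | w.length = ([] : List A).length} = {[]} := by ext; simp
    rw [this, Set.image_singleton]
    simp [compositionReduction, Algebra.adjoin_empty, Algebra.toSubmodule_bot,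
      Submodule.one_eq_span]
  | cons y ys ih =>
    set V := Submodule.span ℚ
      ((fun w => compositionReduction (y :: ys) w []) '' {w | w.length = (y :: ys).length}) with hV
    set S := Algebra.adjoin ℚ {z | z ∈ ys} with hS
    have hyS : ∀ z ∈ ys, z ∈ S := fun z hz => Algebra.subset_adjoin hz
    have hSV : ∀ s ∈ S, s ∈ V := by
      intro s hs
      refine Submodule.span_le.mpr ?_ (ih hs)
      rintro _ ⟨w, hw, rfl⟩
      refine Submodule.subset_span ⟨w ++ [0], by simpa using hw, ?_⟩
      exact compositionReduction_concat_zero y ys w [] (by simpa using hw.le)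
    have hmem : ∀ (w : List ℕ) (a : ℕ), w.length = ys.length →
        compositionReduction (y :: ys) (w ++ [a]) [] ∈ V := fun w a hw =>
      Submodule.subset_span ⟨w ++ [a], by simpa using hw, rfl⟩
    have hsucc : ∀ (w : List ℕ) (a : ℕ), w.length = ys.length →
        compositionReduction (y :: ys) (w ++ [a + 1]) []
          - y * compositionReduction (y :: ys) (w ++ [a]) [] ∈ S := fun w a hw =>
      compositionReduction_concat_succ S.toSubring y ys hyS a w [] (by simpa using hw.le)
    have hind : ∀ z : A, (∀ (w : List ℕ) (a : ℕ), w.length = ys.length →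
        z * compositionReduction (y :: ys) (w ++ [a]) [] ∈ V) → ∀ v ∈ V, z * v ∈ V := by
      intro z hz v hv
      have : V ≤ V.comap (LinearMap.mulLeft ℚ z) := by
        rw [hV, Submodule.span_le]
        rintro _ ⟨w, hw, rfl⟩
        rcases List.eq_nil_or_concat' w with rfl | ⟨w, a, rfl⟩
        · simp at hw
        · exact hz w a (by simpa using hw)
      exact this hv
    have hy : ∀ v ∈ V, y * v ∈ V := hind y fun w a hw => by
      simpa using V.sub_mem (hmem w (a + 1) hw) (hSV _ (hsucc w a hw))
    have hys : ∀ z ∈ ys, ∀ v ∈ V, z * v ∈ V := fun z hz => hind z fun w a hw => by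
      induction a with
      | zero =>
        rw [compositionReduction_concat_zero y ys w [] (by simpa using hw.le)]
        refine hSV _ (S.mul_mem (hyS z hz) ?_)
        exact compositionReduction_mem_subring S.toSubring ys hyS w []
      | succ a ih =>
        have h1 := hy _ ih
        have h2 := hSV _ (S.mul_mem (hyS z hz) (hsucc w a hw))
        convert V.add_mem h2 h1 using 1
        ring
    intro p hp
    have : ∀ v ∈ V, p * v ∈ V := by
      induction hp using Algebra.adjoin_induction with
      | mem z hz =>
        rcases List.mem_cons.mp hz with rfl | hz
        · exact hy
        · exact hys z hz
      | algebraMap r => exact fun v hv => by simpa [Algebra.smul_def] using V.smul_mem r hv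
      | add p q _ _ hp hq =>
        intro v hv
        rw [add_mul]
        exact V.add_mem (hp v hv) (hq v hv)
      | mul p q _ _ hp hq =>
        intro v hv
        rw [mul_assoc]
        exact hp _ (hq v hv)
    simpa using this 1 (hSV 1 S.one_mem)

section QuasiSymmetric

variable {n : ℕ}

lemma sum_single_eq_mapDomain {k : ℕ} (m : Fin k → ℕ) (i : Fin k → Fin (n + 1)) :
    ∑ t, Finsupp.single (i t) (m t) =
      Finsupp.mapDomain i (Finsupp.equivFunOnFinite.symm m) := by
  rw [Finsupp.mapDomain, Finsupp.sum_fintype _ _ (by simp)]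
  simp

lemma coeff_mapDomain_fundamental {k m : ℕ} {f : Fin k → Fin m} (hf : StrictMono f)
    (e : Fin k →₀ ℕ) (u : List ℕ) :
    coeff (e.mapDomain f) (fundamental ((List.finRange m).map X) u : MvPolynomial (Fin m) ℚ) =
      coeff e (fundamental ((List.finRange k).map X) u : MvPolynomial (Fin k) ℚ) := by
  classical
  rw [← coeff_killCompl hf.injective, ← AlgHom.coe_toRingHom, map_fundamental, List.map_map]
  refine congrArg (coeff e) (congrFun ?_ u)
  rw [← fundamental_filter (· ∈ Set.range f)]
  · have : (List.finRange m).filter (· ∈ Set.range f) = (List.finRange k).map f := by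
      refine List.SortedLT.eq_of_mem_iff ?_ ?_ ?_
      · exact ((List.sortedLT_finRange m).pairwise.filter _).sortedLT
      · exact hf.sortedLT_listMap.mpr (List.sortedLT_finRange k)
      · simp
    rw [this, List.map_map]
    congr 1
    refine List.map_congr_left fun t _ => ?_
    have := killCompl_rename_app hf.injective (X t : MvPolynomial (Fin k) ℚ)
    simpa using this
  · intro i _ hi
    simp only [Set.mem_range] at hi
    simp [killCompl, hi]

lemma isQuasiSymmetric_fundamental (u : List ℕ) :
    IsQuasiSymmetric
      (fundamental ((List.finRange (n + 1)).map X) u : MvPolynomial (Fin (n + 1)) ℚ) := by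
  intro k m _ i i' hi hi'
  rw [sum_single_eq_mapDomain, sum_single_eq_mapDomain, coeff_mapDomain_fundamental hi,
    coeff_mapDomain_fundamental hi']

lemma fundamental_mem_Iqs (u : List ℕ) (hu : u ≠ []) :
    (fundamental ((List.finRange (n + 1)).map X) u : MvPolynomial (Fin (n + 1)) ℚ) ∈ Iqs n := by
  refine Ideal.subset_span ⟨isQuasiSymmetric_fundamental u, ?_⟩
  obtain ⟨a, u, rfl⟩ := List.exists_cons_of_ne_nil hu
  have := coeff_mapDomain_fundamental (Subsingleton.strictMono (Fin.elim0 : Fin 0 → Fin (n + 1)))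
    0 (a :: u)
  rw [Finsupp.mapDomain_zero] at this
  rw [this]
  simp [fundamental]

lemma IsQuasiSymmetric.coeff_mapDomain {P : MvPolynomial (Fin (n + 1)) ℚ}
    (hP : IsQuasiSymmetric P) {k : ℕ} {f g : Fin k → Fin (n + 1)} (hf : StrictMono f)
    (hg : StrictMono g) (e : Fin k →₀ ℕ) :
    coeff (e.mapDomain f) P = coeff (e.mapDomain g) P := by
  let s := e.support.orderEmbOfFin rfl
  have he : e = (e.comapDomain s s.injective.injOn).mapDomain s := by
    rw [Finsupp.mapDomain_comapDomain _ s.injective]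
    simp [s]
  have hpos : ∀ t, 0 < e (s t) := fun t => Nat.pos_of_ne_zero
    (Finsupp.mem_support_iff.mp (e.support.orderEmbOfFin_mem rfl t))
  have h := hP _ (fun t => e (s t)) hpos (f ∘ s) (g ∘ s)
    (hf.comp s.strictMono) (hg.comp s.strictMono)
  rw [sum_single_eq_mapDomain, sum_single_eq_mapDomain, Finsupp.mapDomain_comp,
    Finsupp.mapDomain_comp] at h
  have h' : Finsupp.equivFunOnFinite.symm (fun t => e (s t)) =
      e.comapDomain s s.injective.injOn := by ext; simp
  rwa [h', ← he] at h

/-- The map `x_i ↦ 0` on polynomials, with the variables after `x_i` shifted down by one. -/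
noncomputable def killVar (i : Fin (n + 1)) :
    MvPolynomial (Fin (n + 1)) ℚ →ₐ[ℚ] MvPolynomial (Fin n) ℚ :=
  killCompl (Fin.succAbove_right_injective (p := i))

lemma coeff_killVar (i : Fin (n + 1)) (p : MvPolynomial (Fin (n + 1)) ℚ) (e : Fin n →₀ ℕ) :
    coeff e (killVar i p) = coeff (e.mapDomain i.succAbove) p :=
  coeff_killCompl _

lemma IsQuasiSymmetric.killVar_eq {P : MvPolynomial (Fin (n + 1)) ℚ}
    (hP : IsQuasiSymmetric P) (i j : Fin (n + 1)) : killVar i P = killVar j P := by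
  ext e
  rw [coeff_killVar, coeff_killVar]
  exact hP.coeff_mapDomain (Fin.strictMono_succAbove i) (Fin.strictMono_succAbove j) e

lemma IsQuasiSymmetric.killVar {P : MvPolynomial (Fin (n + 2)) ℚ}
    (hP : IsQuasiSymmetric P) (i : Fin (n + 2)) : IsQuasiSymmetric (killVar i P) := by
  intro k m _ f g hf hg
  rw [coeff_killVar, coeff_killVar, sum_single_eq_mapDomain, sum_single_eq_mapDomain,
    ← Finsupp.mapDomain_comp, ← Finsupp.mapDomain_comp]
  exact hP.coeff_mapDomain ((Fin.strictMono_succAbove i).comp hf)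
    ((Fin.strictMono_succAbove i).comp hg) _

lemma X_dvd_killVar_sub (j : Fin n) (p : MvPolynomial (Fin (n + 1)) ℚ) :
    X j ∣ killVar j.succ p - killVar j.castSucc p := by
  rw [X_dvd_iff_modMonomial_eq_zero]
  ext e
  by_cases he : Finsupp.single j 1 ≤ e
  · rw [coeff_modMonomial_of_le _ he, coeff_zero]
  · rw [coeff_modMonomial_of_not_le _ he, coeff_sub, coeff_killVar, coeff_killVar, coeff_zero,
      sub_eq_zero]
    congr 1
    refine Finsupp.mapDomain_congr fun t ht => ?_
    have htj : t ≠ j := by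
      rintro rfl
      exact he (Finsupp.single_le_iff.mpr
        (Nat.one_le_iff_ne_zero.mpr (Finsupp.mem_support_iff.mp ht)))
    rcases lt_or_gt_of_ne htj with h | h
    · rw [Fin.succAbove_of_castSucc_lt, Fin.succAbove_of_castSucc_lt] <;>
        simp only [Fin.lt_def, Fin.val_castSucc, Fin.val_succ] at h ⊢ <;> omega
    · rw [Fin.succAbove_of_le_castSucc, Fin.succAbove_of_le_castSucc] <;>
        simp only [Fin.lt_def, Fin.le_def, Fin.val_castSucc, Fin.val_succ] at h ⊢ <;> omega

lemma exists_X_mul_eq_killVar_sub {p : MvPolynomial (Fin (n + 2)) ℚ} (hp : p ∈ Iqs (n + 1))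
    (j : Fin (n + 1)) :
    ∃ q ∈ Iqs n, X j * q = killVar j.succ p - killVar j.castSucc p := by
  induction hp using Submodule.span_induction with
  | mem p hp => exact ⟨0, zero_mem _, by simp [hp.1.killVar_eq j.succ j.castSucc]⟩
  | zero => exact ⟨0, zero_mem _, by simp⟩
  | add p q _ _ hp hq =>
    obtain ⟨p', hp', hp⟩ := hp
    obtain ⟨q', hq', hq⟩ := hq
    exact ⟨p' + q', add_mem hp' hq', by rw [mul_add, hp, hq, map_add, map_add]; ring⟩
  | smul f p hp ih =>
    obtain ⟨q, hq, hpq⟩ := ih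
    obtain ⟨r, hr⟩ := X_dvd_killVar_sub j f
    refine ⟨killVar j.succ f * q + r * killVar j.castSucc p,
      add_mem (Ideal.mul_mem_left _ _ hq) (Ideal.mul_mem_left _ _ ?_), ?_⟩
    · have : Iqs (n + 1) ≤ (Iqs n).comap (killVar j.castSucc) := by
        rw [Iqs, Ideal.span_le]
        rintro P ⟨hP, hP0⟩
        refine Ideal.subset_span ⟨hP.killVar _, ?_⟩
        rwa [coeff_killVar, Finsupp.mapDomain_zero]
      exact this hp
    · rw [smul_eq_mul, map_mul, map_mul, mul_add, mul_left_comm, hpq, ← mul_assoc, ← hr]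
      ring

lemma coeff_zero_of_mem_Iqs {p : MvPolynomial (Fin (n + 1)) ℚ} (hp : p ∈ Iqs n) :
    coeff 0 p = 0 := by
  have : Iqs n ≤ RingHom.ker (constantCoeff (R := ℚ) (σ := Fin (n + 1))) := by
    rw [Iqs, Ideal.span_le]
    exact fun P hP => hP.2
  exact this hp

/-- The exponents `c` with `c_0 + ⋯ + c_k ≤ k` for all `k`. -/
def ballotExponents (n : ℕ) : Set (Fin n →₀ ℕ) :=
  {c | ∀ k : Fin n, (c.sum fun t a => if t ≤ k then a else 0) ≤ k}

lemma mem_ballotExponents_of_mapDomain {i : Fin (n + 1)} {j : Fin n}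
    (hij : i = j.castSucc ∨ i = j.succ) {e : Fin n →₀ ℕ}
    (h : (e + Finsupp.single j 1).mapDomain i.succAbove ∈ ballotExponents (n + 1)) :
    e ∈ ballotExponents n := by
  intro k
  have key : ∀ l : Fin (n + 1), ((e + Finsupp.single j 1).mapDomain i.succAbove).sum
      (fun t a => if t ≤ l then a else 0) = (e.sum fun t a => if i.succAbove t ≤ l then a else 0) +
        if i.succAbove j ≤ l then 1 else 0 := by
    intro l
    rw [Finsupp.sum_mapDomain_index (by simp) (by intros; split_ifs <;> simp),
      Finsupp.sum_add_index' (by simp) (by intros; split_ifs <;> simp),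
      Finsupp.sum_single_index (by simp)]
  rcases lt_or_ge k j with hk | hk
  · have := h k.castSucc
    rw [key] at this
    have h' : ∀ t, i.succAbove t ≤ k.castSucc ↔ t ≤ k := by
      intro t
      rcases hij with rfl | rfl <;> simp only [Fin.succAbove] <;> split_ifs <;>
        simp only [Fin.lt_def, Fin.le_def, Fin.val_castSucc, Fin.val_succ] at * <;> omega
    simp only [h'] at this
    exact (Nat.le_add_right _ _).trans this
  · have := h k.succ
    rw [key] at this
    have h' : ∀ t, i.succAbove t ≤ k.succ ↔ t ≤ k := by
      intro t
      rcases hij with rfl | rfl <;> simp only [Fin.succAbove] <;> split_ifs <;>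
        simp only [Fin.lt_def, Fin.le_def, Fin.val_castSucc, Fin.val_succ] at * <;> omega
    simpa only [h', hk, if_true, Fin.val_succ, add_le_add_iff_right] using this

lemma eq_zero_of_killVar_eq {p : MvPolynomial (Fin (n + 1)) ℚ} (h0 : coeff 0 p = 0)
    (hp : ∀ c ∈ p.support, c ∈ ballotExponents (n + 1))
    (h : ∀ j : Fin n, killVar j.succ p = killVar j.castSucc p) : p = 0 := by
  have key : ∀ (k : Fin (n + 1)) (c : Fin (n + 1) →₀ ℕ), 0 < c k → (∀ t < k, c t = 0) →
      coeff c p = 0 := by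
    intro k
    induction k using Fin.induction with
    | zero =>
      intro c hc _
      by_contra hne
      have := hp c (mem_support_iff.mpr hne) 0
      rw [Finsupp.sum_fintype _ _ (by simp)] at this
      simp only [Fin.le_zero_iff, Finset.sum_ite_eq', Finset.mem_univ, if_true] at this
      simp at this
      omega
    | succ j ih =>
      intro c hc hlt
      have hc' : c = (c.comapDomain j.castSucc.succAbove
          Fin.succAbove_right_injective.injOn).mapDomain j.castSucc.succAbove := by
        rw [Finsupp.mapDomain_comapDomain _ Fin.succAbove_right_injective]
        rw [Fin.range_succAbove]
        intro t ht
        rintro rfl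
        exact Finsupp.mem_support_iff.mp ht (hlt _ (Fin.castSucc_lt_succ))
      rw [hc', ← coeff_killVar, ← h, coeff_killVar]
      apply ih
      · have := Finsupp.mapDomain_apply (Fin.succAbove_right_injective (p := j.succ))
          (c.comapDomain j.castSucc.succAbove Fin.succAbove_right_injective.injOn) j
        rw [Fin.succAbove_of_castSucc_lt _ _ Fin.castSucc_lt_succ] at this
        rw [this]
        simpa using hc
      · intro t ht
        obtain ⟨t, rfl⟩ := Fin.exists_castSucc_eq.mpr (ht.trans_le (Fin.le_last _)).ne
        have := Finsupp.mapDomain_apply (Fin.succAbove_right_injective (p := j.succ))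
          (c.comapDomain j.castSucc.succAbove Fin.succAbove_right_injective.injOn) t
        have ht' : t < j := by simpa using ht
        rw [Fin.succAbove_of_castSucc_lt _ _ (ht.trans Fin.castSucc_lt_succ)] at this
        rw [this, Finsupp.comapDomain_apply, Fin.succAbove_of_castSucc_lt _ _ ht]
        exact hlt _ (ht.trans Fin.castSucc_lt_succ)
  ext c
  rw [coeff_zero]
  by_cases hc : c = 0
  · rw [hc, h0]
  · have hs : c.support.Nonempty := Finsupp.support_nonempty_iff.mpr hc
    refine key (c.support.min' hs) c
      (Nat.pos_of_ne_zero (Finsupp.mem_support_iff.mp (c.support.min'_mem hs))) fun t ht => ?_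
    by_contra hne
    exact absurd (c.support.min'_le t (Finsupp.mem_support_iff.mpr hne)) (not_le.mpr ht)

lemma eq_zero_of_mem_Iqs {p : MvPolynomial (Fin (n + 1)) ℚ} (hI : p ∈ Iqs n)
    (hp : ∀ c ∈ p.support, c ∈ ballotExponents (n + 1)) : p = 0 := by
  induction n with
  | zero => exact eq_zero_of_killVar_eq (coeff_zero_of_mem_Iqs hI) hp fun j => j.elim0
  | succ n ih =>
    refine eq_zero_of_killVar_eq (coeff_zero_of_mem_Iqs hI) hp fun j => ?_
    obtain ⟨q, hq, hqp⟩ := exists_X_mul_eq_killVar_sub hI j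
    have : q = 0 := by
      refine ih hq fun e he => ?_
      have hne : coeff (e + Finsupp.single j 1) (X j * q) ≠ 0 := by
        rw [mul_comm, coeff_mul_X]
        exact mem_support_iff.mp he
      rw [hqp, coeff_sub, coeff_killVar, coeff_killVar] at hne
      by_contra hcon
      have hcoeff : ∀ i, i = j.castSucc ∨ i = j.succ →
          coeff ((e + Finsupp.single j 1).mapDomain i.succAbove) p = 0 := fun i hi =>
        notMem_support_iff.mp fun hmem => hcon (mem_ballotExponents_of_mapDomain hi (hp _ hmem))
      exact hne (by rw [hcoeff _ (Or.inl rfl), hcoeff _ (Or.inr rfl), sub_zero])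
    rw [this, mul_zero] at hqp
    exact sub_eq_zero.mp hqp.symm

end QuasiSymmetric

section Ballot

open Finset

/-- The lists of length `n` with sum at most `s` all of whose nonempty suffixes have sum smaller
than their length. -/
def ballotLists : ℕ → ℕ → Finset (List ℕ)
  | 0, _ => {[]}
  | n + 1, s => (range (min s n + 1)).biUnion fun a =>
      (ballotLists n (min s n - a)).image (List.cons a)

lemma mem_ballotLists {n s : ℕ} {w : List ℕ} :
    w ∈ ballotLists n s ↔
      w.length = n ∧ w.sum ≤ s ∧ ∀ v, v <:+ w → v ≠ [] → v.sum < v.length := by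
  induction n generalizing s w with
  | zero =>
    simp only [ballotLists, mem_singleton, List.length_eq_zero_iff]
    constructor
    · rintro rfl
      exact ⟨rfl, by simp, fun v hv hv' => absurd (List.suffix_nil.mp hv) hv'⟩
    · exact fun h => h.1
  | succ n ih =>
    simp only [ballotLists, mem_biUnion, mem_image, mem_range, ih]
    constructor
    · rintro ⟨a, ha, w, ⟨hw, hs, h⟩, rfl⟩
      refine ⟨by simp [hw], by simp; omega, fun v hv hv' => ?_⟩
      rcases List.suffix_cons_iff.mp hv with rfl | hv
      · simp; omega
      · exact h v hv hv'
    · rintro ⟨hw, hs, h⟩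
      obtain ⟨a, w, rfl⟩ := List.exists_cons_of_length_eq_add_one hw
      have h1 := h _ List.suffix_rfl (by simp)
      simp at hw hs h1
      exact ⟨a, by omega, w, ⟨hw, by omega, fun v hv => h v (hv.trans (List.suffix_cons _ _))⟩,
        rfl⟩

lemma card_ballotLists_succ {n s : ℕ} (hs : s ≤ n) :
    (ballotLists (n + 1) s).card = ∑ t ∈ range (s + 1), (ballotLists n t).card := by
  rw [ballotLists, card_biUnion, ← sum_range_reflect]
  · rw [min_eq_left hs]
    refine sum_congr rfl fun a ha => ?_
    rw [card_image_of_injective _ List.cons_injective]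
    congr 2
    have := mem_range.mp ha
    omega
  · intro a _ b _ hab
    simp only [Function.onFun, disjoint_left, mem_image]
    rintro _ ⟨v, _, rfl⟩ ⟨v', _, h⟩
    exact hab (List.cons.inj h).1.symm

lemma card_ballotLists {n s : ℕ} (hs : s ≤ n) :
    (ballotLists n s).card + (n + s).choose (n + 1) = (n + s).choose n := by
  induction n generalizing s with
  | zero =>
    obtain rfl : s = 0 := by omega
    simp [ballotLists]
  | succ n ih =>
    have key : ∀ s ≤ n, (ballotLists (n + 1) s).card + (n + 1 + s).choose (n + 2) =
        (n + 1 + s).choose (n + 1) := by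
      intro s hs
      rw [card_ballotLists_succ hs]
      induction s with
      | zero => simpa using ih (s := 0) (by omega)
      | succ s ihs =>
        rw [sum_range_succ]
        have h1 := ihs (by omega)
        have h2 := ih hs
        have e1 : n + 1 + (s + 1) = (n + 1 + s) + 1 := by ring
        rw [e1, Nat.choose_succ_succ' _ (n + 1), Nat.choose_succ_succ' _ n]
        rw [show n + (s + 1) = n + 1 + s by ring] at h2
        simp only [add_assoc, Nat.reduceAdd] at *
        omega
    rcases hs.lt_or_eq with hs | rfl
    · exact key s (by omega)
    · have h1 : ballotLists (n + 1) (n + 1) = ballotLists (n + 1) n := by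
        simp [ballotLists]
      have h2 := key n le_rfl
      have h3 : (2 * n + 1).choose (n + 1) = (2 * n + 1).choose n := Nat.choose_symm_half n
      rw [show n + 1 + n = 2 * n + 1 by ring] at h2
      rw [h1, show n + 1 + (n + 1) = (2 * n + 1) + 1 by ring,
        Nat.choose_succ_succ' (2 * n + 1) (n + 1), Nat.choose_succ_succ' (2 * n + 1) n]
      simp only [add_assoc, Nat.reduceAdd] at *
      omega

lemma card_ballotLists_self (n : ℕ) :
    (ballotLists n n).card = (2 * n).choose n / (n + 1) := by
  have h := card_ballotLists (le_refl n)
  have h' := Nat.choose_succ_right_eq (2 * n) n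
  rw [show 2 * n - n = n by omega] at h'
  rw [← two_mul] at h
  refine (Nat.div_eq_of_eq_mul_left n.succ_pos ?_).symm
  rw [← h] at h' ⊢
  linarith

lemma sum_ite_getD (l : List ℕ) (k : ℕ) (hk : k < l.length) :
    ∑ t : Fin l.length, (if (t : ℕ) ≤ k then l.getD t 0 else 0) = (l.take (k + 1)).sum := by
  induction l generalizing k with
  | nil => simp at hk
  | cons a l ih =>
    simp only [List.length_cons]
    rw [Fin.sum_univ_succ]
    rcases k with _ | k
    · simp
    · have := ih k (by simpa using hk)
      simpa using this

/-- The exponent vector whose entries are listed, from last to first, by `w`. -/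
noncomputable def reverseExponent (n : ℕ) (w : List ℕ) : Fin n →₀ ℕ :=
  Finsupp.equivFunOnFinite.symm fun i => w.reverse.getD i 0

lemma reverseExponent_mem {n s : ℕ} {w : List ℕ} (hw : w ∈ ballotLists n s) :
    reverseExponent n w ∈ ballotExponents n := by
  obtain ⟨rfl, -, h⟩ := mem_ballotLists.mp hw
  intro k
  rw [Finsupp.sum_fintype _ _ (by simp)]
  have := sum_ite_getD w.reverse k (by simp)
  rw [List.take_reverse, List.sum_reverse] at this
  have hlt := h (w.drop (w.length - (k + 1))) (List.drop_suffix _ _) (by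
    rw [Ne, List.drop_eq_nil_iff]; omega)
  rw [← this, List.length_drop] at hlt
  have hcast : ∑ t : Fin w.reverse.length, (if (t : ℕ) ≤ k then w.reverse.getD t 0 else 0) =
      ∑ t : Fin w.length, (if (t : ℕ) ≤ k then w.reverse.getD t 0 else 0) :=
    Fintype.sum_equiv (finCongr (by simp)) _ _ fun t => rfl
  rw [hcast] at hlt
  have : ∑ t : Fin w.length, (if t ≤ k then reverseExponent w.length w t else 0) =
      ∑ t : Fin w.length, (if (t : ℕ) ≤ k then w.reverse.getD t 0 else 0) := rfl
  omega

lemma reverseExponent_injOn (n : ℕ) : Set.InjOn (reverseExponent n) {w | w.length = n} := by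
  rintro w hw v hv h
  simp only [Set.mem_ofPred_eq] at hw hv
  rw [← List.reverse_inj]
  refine List.ext_getElem (by simp [hw, hv]) fun i hi hi' => ?_
  have := DFunLike.congr_fun h ⟨i, by simpa [hw] using hi⟩
  change w.reverse.getD i 0 = v.reverse.getD i 0 at this
  rwa [List.getD_eq_getElem _ _ hi, List.getD_eq_getElem _ _ hi'] at this

end Ballot

lemma span_compositionReduction_eq_top (n : ℕ) :
    Submodule.span ℚ (Set.range fun w : ballotLists (n + 1) (n + 1) =>
      Ideal.Quotient.mk (Iqs n) (compositionReduction ((List.finRange (n + 1)).map X) w [])) =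
      ⊤ := by
  rw [eq_top_iff]
  rintro q -
  obtain ⟨p, rfl⟩ := Ideal.Quotient.mk_surjective q
  have hp : p ∈ Subalgebra.toSubmodule
      (Algebra.adjoin ℚ {y | y ∈ (List.finRange (n + 1)).map (X (R := ℚ))}) := by
    have : {y | y ∈ (List.finRange (n + 1)).map (X (R := ℚ))} = Set.range X := by
      ext; simp
    rw [this, adjoin_range_X]
    simp
  have hp := Submodule.mem_map_of_mem (f := (Ideal.Quotient.mkₐ ℚ (Iqs n)).toLinearMap)
    (adjoin_le_span_compositionReduction _ hp)
  rw [Submodule.map_span] at hp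
  refine Submodule.span_le.mpr ?_ hp
  rintro _ ⟨_, ⟨w, hw, rfl⟩, rfl⟩
  simp only [List.length_map, List.length_finRange, Set.mem_ofPred_eq] at hw
  by_cases hgood : ∀ v, v <:+ w → v ≠ [] → v.sum < v.length
  · refine Submodule.subset_span ⟨⟨w, mem_ballotLists.mpr ⟨hw, ?_, hgood⟩⟩, rfl⟩
    have := hgood w List.suffix_rfl (by rintro rfl; simp at hw)
    omega
  · push Not at hgood
    have := compositionReduction_mem_ideal (Iqs n) _ fundamental_mem_Iqs w [] (Or.inl hgood)
    simp [Ideal.Quotient.eq_zero_iff_mem.mpr this]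

lemma linearIndependent_monomial_reverseExponent (n : ℕ) :
    LinearIndependent ℚ (fun w : ballotLists (n + 1) (n + 1) =>
      Ideal.Quotient.mk (Iqs n) (monomial (reverseExponent (n + 1) w) (1 : ℚ))) := by
  have hinj : Function.Injective
      fun w : ballotLists (n + 1) (n + 1) => reverseExponent (n + 1) w := fun w v h =>
    Subtype.ext (reverseExponent_injOn (n + 1) (mem_ballotLists.mp w.2).1
      (mem_ballotLists.mp v.2).1 h)
  have hli := (basisMonomials (Fin (n + 1)) ℚ).linearIndependent.comp _ hinj
  refine hli.map (f := (Ideal.Quotient.mkₐ ℚ (Iqs n)).toLinearMap) ?_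
  rw [Submodule.disjoint_def]
  intro p hp hker
  have hI : p ∈ Iqs n := Ideal.Quotient.eq_zero_iff_mem.mp hker
  refine eq_zero_of_mem_Iqs hI ?_
  have hle : Submodule.span ℚ (Set.range (basisMonomials (Fin (n + 1)) ℚ ∘
      fun w : ballotLists (n + 1) (n + 1) => reverseExponent (n + 1) w)) ≤
      restrictSupport ℚ (ballotExponents (n + 1)) := by
    rw [Submodule.span_le]
    rintro _ ⟨w, rfl⟩
    intro c hc
    have := support_monomial_subset (Finset.mem_coe.mp hc)
    rw [Finset.mem_singleton.mp this]
    exact reverseExponent_mem w.2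
  exact fun c hc => hle hp hc

/-- The quasi-symmetric coinvariant algebra `Q_n` is a finite-dimensional
`ℚ`-vector space of dimension the Catalan number
`c_{n+1} = (1/(n+2))·binom(2n+2, n+1)`. -/
theorem stmt_10 (n : ℕ) :
    FiniteDimensional ℚ (MvPolynomial (Fin (n+1)) ℚ ⧸ Iqs n) ∧
    Module.finrank ℚ (MvPolynomial (Fin (n+1)) ℚ ⧸ Iqs n) =
      (2 * n + 2).choose (n + 1) / (n + 2) := by
  have hspan := span_compositionReduction_eq_top n
  have hfin : FiniteDimensional ℚ (MvPolynomial (Fin (n+1)) ℚ ⧸ Iqs n) :=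
    ⟨hspan ▸ Submodule.fg_span (Set.finite_range _)⟩
  have hcard := card_ballotLists_self (n + 1)
  have hle := finrank_range_le_card (R := ℚ) (fun w : ballotLists (n + 1) (n + 1) =>
    Ideal.Quotient.mk (Iqs n) (compositionReduction ((List.finRange (n + 1)).map X) w []))
  rw [Set.finrank, hspan, finrank_top, Fintype.card_coe] at hle
  have hge := (linearIndependent_monomial_reverseExponent n).fintype_card_le_finrank
  rw [Fintype.card_coe] at hge
  exact ⟨hfin, (hle.antisymm hge).trans hcard⟩
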